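/- arXiv:math/9904140 — 2 statements merged into one kernel-verified Lean document; each statement's English description precedes it below -/
import Mathlib

section
/- For every graph G, χ(G) ≤ w(G), where w(G) = 1 + max over nonempty subgraphs H of δ(H) is the Szekeres–Wilf number. -/
/-- The minimum degree of a subgraph (degree measured inside the subgraph). -/
noncomputable def subMinDegree {V : Type*} {G : SimpleGraph V} (H : G.Subgraph) : ℕ :=
  sInf {d | ∃ v ∈ H.verts, (H.neighborSet v).ncard = d}

/-- The Szekeres–Wilf number: one plus the maximum, over nonempty subgraphs,
of the minimum degree. -/
noncomputable def szekeresWilf {V : Type*} [Fintype V] (G : SimpleGraph V) : ℕ :=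
  1 + sSup {d | ∃ H : G.Subgraph, H.verts.Nonempty ∧ subMinDegree H = d}

theorem szekeresWilf_exists_small {V : Type*} [Fintype V] (G : SimpleGraph V)
    (S : Finset V) (hS : S.Nonempty) :
    ∃ v ∈ S, {u | u ∈ S ∧ G.Adj v u}.ncard < szekeresWilf G := by
  classical
  let H : G.Subgraph := (⊤ : G.Subgraph).induce (S : Set V)
  have hne : H.verts.Nonempty := by simpa [H] using hS
  have hmem : subMinDegree H ∈ {d | ∃ v ∈ H.verts, (H.neighborSet v).ncard = d} := by
    apply Nat.sInf_mem
    obtain ⟨v, hv⟩ := hne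
    exact ⟨_, v, hv, rfl⟩
  obtain ⟨v, hv, hd⟩ := hmem
  have hvS : v ∈ S := by simpa [H] using hv
  refine ⟨v, hvS, ?_⟩
  have hset : H.neighborSet v = {u | u ∈ S ∧ G.Adj v u} := by
    ext u
    simp [H, hvS]
  rw [← hset, hd]
  have hb : BddAbove {d | ∃ H : G.Subgraph, H.verts.Nonempty ∧ subMinDegree H = d} := by
    refine ⟨Fintype.card V, ?_⟩
    rintro d ⟨K, ⟨x, hx⟩, rfl⟩
    have h0 : subMinDegree K ≤ (K.neighborSet x).ncard := Nat.sInf_le ⟨x, hx, rfl⟩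
    refine h0.trans ?_
    rw [← Nat.card_eq_fintype_card]
    exact Set.ncard_le_card _
  have := le_csSup hb ⟨H, hne, rfl⟩
  unfold szekeresWilf
  omega

theorem szekeresWilf_color {V : Type*} [Fintype V] (G : SimpleGraph V) (S : Finset V) :
    ∃ c : V → Fin (szekeresWilf G), ∀ u ∈ S, ∀ v ∈ S, G.Adj u v → c u ≠ c v := by
  classical
  induction S using Finset.strongInduction with
  | H S ih =>
    rcases S.eq_empty_or_nonempty with rfl | hS
    · exact ⟨fun _ => ⟨0, by unfold szekeresWilf; omega⟩, by simp⟩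
    obtain ⟨v, hv, hlt⟩ := szekeresWilf_exists_small G S hS
    obtain ⟨c, hc⟩ := ih (S.erase v) (Finset.erase_ssubset hv)
    obtain ⟨a, ha⟩ : ∃ a, a ∉ (S.filter (G.Adj v)).image c := by
      by_contra! h
      have h1 : (S.filter (G.Adj v)).image c = Finset.univ := Finset.eq_univ_iff_forall.2 h
      have h2 := Finset.card_image_le (s := S.filter (G.Adj v)) (f := c)
      rw [h1, Finset.card_univ, Fintype.card_fin] at h2
      have h3 : {u | u ∈ S ∧ G.Adj v u} = ((S.filter (G.Adj v) : Finset V) : Set V) := by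
        ext; simp
      rw [h3, Set.ncard_coe_finset] at hlt
      omega
    have ha' : ∀ u ∈ S, G.Adj v u → c u ≠ a := fun u hu huv h =>
      ha (Finset.mem_image.2 ⟨u, Finset.mem_filter.2 ⟨hu, huv⟩, h⟩)
    refine ⟨Function.update c v a, fun x hx y hy hxy => ?_⟩
    by_cases hxv : x = v
    · subst hxv
      have : y ≠ x := hxy.ne'
      simpa [Function.update_of_ne this] using (ha' y hy hxy).symm
    · by_cases hyv : y = v
      · subst hyv
        simpa [Function.update_of_ne hxv] using ha' x hx hxy.symm
      · simpa [Function.update_of_ne hxv, Function.update_of_ne hyv] using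
          hc x (Finset.mem_erase.2 ⟨hxv, hx⟩) y (Finset.mem_erase.2 ⟨hyv, hy⟩) hxy

theorem chromaticNumber_le_szekeresWilf {V : Type*} [Fintype V] (G : SimpleGraph V) :
    G.chromaticNumber ≤ (szekeresWilf G : ℕ∞) := by
  obtain ⟨c, hc⟩ := szekeresWilf_color G Finset.univ
  have : G.Colorable (szekeresWilf G) :=
    ⟨SimpleGraph.Coloring.mk c (fun {u v} h => hc u (Finset.mem_univ _) v (Finset.mem_univ _) h)⟩
  exact this.chromaticNumber_le
end

section
/- For every tree T with at least 2 vertices, s(T) / Δ(T) ≤ 1/Δ(T) + 1/2 + 1/(2Δ(T)); consequently the ratio s(T)/Δ(T) over all nontrivial trees is bounded above, and the supremum of limit points of s(T_n)/Δ(T_n) over sequences of trees with Δ(T_n) → ∞ is 1/2. -/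
open Finset

/-- A proper coloring with positive integer colors. -/
def IsProperColoring {V : Type*} (G : SimpleGraph V) (f : V → ℕ) : Prop :=
  (∀ v, 1 ≤ f v) ∧ ∀ ⦃u v⦄, G.Adj u v → f u ≠ f v

/-- The chromatic sum of a graph. -/
noncomputable def chromSum {V : Type*} [Fintype V] (G : SimpleGraph V) : ℕ :=
  sInf {s | ∃ f : V → ℕ, IsProperColoring G f ∧ ∑ v, f v = s}

/-- The strength: minimum number of distinct colors among minimal colorings. -/
noncomputable def strength {V : Type*} [Fintype V] (G : SimpleGraph V) : ℕ :=
  sInf {n | ∃ f : V → ℕ, IsProperColoring G f ∧ ∑ v, f v = chromSum G ∧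
    (Finset.univ.image f).card = n}

section Upper
variable {V : Type*}

/-- The side of `x` after removing the edge `p x`. -/
def side (G : SimpleGraph V) (p x : V) : Set V :=
  {w | (G.deleteEdges {s(p, x)}).Reachable x w}

lemma side_self (G : SimpleGraph V) (p x : V) : x ∈ side G p x := SimpleGraph.Reachable.refl _

lemma side_parent {G : SimpleGraph V} (hG : G.IsAcyclic) {p x : V} (h : G.Adj p x) :
    p ∉ side G p x := fun hp =>
  (SimpleGraph.isAcyclic_iff_forall_adj_isBridge.1 hG h) hp.symm

lemma side_nbr {G : SimpleGraph V} (hG : G.IsAcyclic) {p x z : V} (h : G.Adj p x)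
    (hz : G.Adj p z) (hzx : z ≠ x) : z ∉ side G p x := fun hp => by
  apply side_parent hG h
  refine SimpleGraph.Reachable.trans hp (SimpleGraph.Adj.reachable ?_)
  rw [SimpleGraph.deleteEdges_adj]
  refine ⟨hz.symm, ?_⟩
  simp only [Set.mem_singleton_iff, Sym2.eq_iff, not_or]
  exact ⟨fun h' => hz.ne h'.1.symm, fun h' => hzx h'.1⟩

lemma side_subset {G : SimpleGraph V} (hG : G.IsAcyclic) {p x y : V} (h : G.Adj p x)
    (hy : G.Adj x y) (hyp : y ≠ p) : side G x y ⊆ side G p x := by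
  intro w hw
  have hw' : Relation.ReflTransGen (G.deleteEdges {s(x, y)}).Adj y w :=
    (SimpleGraph.reachable_iff_reflTransGen _ _).1 hw
  clear hw
  induction hw' with
  | refl =>
    refine SimpleGraph.Adj.reachable ?_
    rw [SimpleGraph.deleteEdges_adj]
    refine ⟨hy, ?_⟩
    simp only [Set.mem_singleton_iff, Sym2.eq_iff, not_or]
    exact ⟨fun h' => h.ne h'.1.symm, fun h' => hyp h'.2⟩
  | @tail a b hab hstep ih =>
    refine SimpleGraph.Reachable.trans ih (SimpleGraph.Adj.reachable ?_)
    have ha : a ≠ x := by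
      rintro rfl
      exact side_parent hG hy ((SimpleGraph.reachable_iff_reflTransGen _ _).2 hab)
    have hb : b ≠ x := by
      rintro rfl
      exact side_parent hG hy ((SimpleGraph.reachable_iff_reflTransGen _ _).2 (hab.tail hstep))
    rw [SimpleGraph.deleteEdges_adj] at hstep ⊢
    refine ⟨hstep.1, ?_⟩
    simp only [Set.mem_singleton_iff, Sym2.eq_iff, not_or]
    exact ⟨fun heq => hb heq.2, fun heq => ha heq.1⟩

/-- Pigeonhole: some color of `C` is used at most once on `N`. -/
lemma exists_rare [DecidableEq V] (N : Finset V) (f : V → ℕ) (C : Finset ℕ)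
    (h : N.card < 2 * C.card) : ∃ c ∈ C, (N.filter (fun z => f z = c)).card ≤ 1 := by
  by_contra! hc
  have h1 : ∑ c ∈ C, 2 ≤ ∑ c ∈ C, (N.filter (fun z => f z = c)).card :=
    Finset.sum_le_sum fun c hcC => hc c hcC
  have h2 : ∑ c ∈ C, (N.filter (fun z => f z = c)).card ≤ N.card := by
    rw [← Finset.card_biUnion]
    · apply Finset.card_le_card
      intro z hz
      simp only [Finset.mem_biUnion, Finset.mem_filter] at hz
      obtain ⟨_, _, hz, _⟩ := hz
      exact hz
    · intro a _ b _ hab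
      rw [Function.onFun, Finset.disjoint_left]
      intro z hz hz'
      simp only [Finset.mem_filter] at hz hz'
      exact hab (hz.2.symm.trans hz'.2)
  simp at h1
  omega

lemma sum_update [Fintype V] [DecidableEq V] (f : V → ℕ) (x : V) (c : ℕ) :
    ∑ v, Function.update f x c v + f x = ∑ v, f v + c := by
  have h1 := Finset.add_sum_erase Finset.univ (Function.update f x c) (Finset.mem_univ x)
  have h2 := Finset.add_sum_erase Finset.univ f (Finset.mem_univ x)
  have h3 : ∑ v ∈ Finset.univ.erase x, Function.update f x c v
      = ∑ v ∈ Finset.univ.erase x, f v := by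
    apply Finset.sum_congr rfl
    intro v hv
    rw [Function.update_of_ne (Finset.ne_of_mem_erase hv)]
  simp only [Function.update_self] at h1
  omega

/-- One recoloring step at `x`, where `N` is the set of relevant neighbours
(all of them but possibly a parent), given recolorings of the subtrees below. -/
lemma recolor_step [Fintype V] [DecidableEq V] {G : SimpleGraph V} (hG : G.IsAcyclic)
    (f : V → ℕ) (hf1 : ∀ v, 1 ≤ f v) (hf : ∀ ⦃u v⦄, G.Adj u v → f u ≠ f v) (k : ℕ) (x : V)
    (N : Finset V) (hN : ∀ z ∈ N, G.Adj x z)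
    (ih : ∀ y ∈ N, ∃ h : V → ℕ, (∀ v, 1 ≤ h v) ∧
      (∀ ⦃u v⦄, G.Adj u v → s(u, v) ≠ s(x, y) → h u ≠ h v) ∧
      (∀ v, v ∉ side G x y → h v = f v) ∧ h y ≠ f y ∧ ∑ v, h v + f y < ∑ v, f v + k)
    (C : Finset ℕ) (hC : ∀ c ∈ C, 1 ≤ c ∧ c < k ∧ c ≠ f x) (hcard : N.card < 2 * C.card) :
    ∃ h : V → ℕ, (∀ v, 1 ≤ h v) ∧
      (∀ ⦃u v⦄, G.Adj u v → u ≠ x → v ≠ x → h u ≠ h v) ∧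
      (∀ z ∈ N, h z ≠ h x) ∧
      (∀ v, v ≠ x → (∀ y ∈ N, v ∉ side G x y) → h v = f v) ∧ h x ≠ f x ∧
      ∑ v, h v + f x < ∑ v, f v + k := by
  obtain ⟨c, hcC, hc⟩ := exists_rare N f C hcard
  obtain ⟨hc1, hck, hcx⟩ := hC c hcC
  rcases Finset.eq_empty_or_nonempty (N.filter (fun z => f z = c)) with he | ⟨y, hy⟩
  · refine ⟨Function.update f x c, ?_, ?_, ?_, ?_, ?_, ?_⟩
    · intro v
      by_cases hv : v = x
      · subst hv; simpa
      · rw [Function.update_of_ne hv]; exact hf1 v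
    · intro u v huv hu hv
      rw [Function.update_of_ne hv, Function.update_of_ne hu]; exact hf huv
    · intro z hz
      rw [Function.update_of_ne (hN z hz).ne', Function.update_self]
      intro hzc
      have : z ∈ N.filter (fun z => f z = c) := by simp [hz, hzc]
      rw [he] at this
      simp at this
    · intro v hv _
      rw [Function.update_of_ne hv]
    · simpa using hcx
    · have := sum_update f x c
      omega
  · have hy' := Finset.mem_filter.1 hy
    obtain ⟨h, h1, h2, h3, h4, h5⟩ := ih y hy'.1
    have hxy := hN y hy'.1
    have hx : h x = f x := h3 x (side_parent hG hxy)
    refine ⟨Function.update h x c, ?_, ?_, ?_, ?_, ?_, ?_⟩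
    · intro v
      by_cases hv : v = x
      · subst hv; simpa
      · rw [Function.update_of_ne hv]; exact h1 v
    · intro u v huv hu hv
      rw [Function.update_of_ne hv, Function.update_of_ne hu]
      apply h2 huv
      simp only [ne_eq, Sym2.eq_iff, not_or]
      exact ⟨fun h' => hu h'.1, fun h' => hv h'.2⟩
    · intro z hz
      rw [Function.update_of_ne (hN z hz).ne', Function.update_self]
      by_cases hzy : z = y
      · subst hzy
        rw [← hy'.2]; exact h4
      · rw [h3 z (side_nbr hG hxy (hN z hz) hzy)]
        intro hzc
        exact hzy (Finset.card_le_one.1 hc z (by simp [hz, hzc]) y hy)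
    · intro v hv hv'
      rw [Function.update_of_ne hv]
      exact h3 v (hv' y hy'.1)
    · simpa using hcx
    · have := sum_update h x c
      have := hy'.2
      omega

lemma recolor [Fintype V] [DecidableEq V] {G : SimpleGraph V} [DecidableRel G.Adj]
    (hG : G.IsAcyclic)
    (f : V → ℕ) (hf1 : ∀ v, 1 ≤ f v) (hf : ∀ ⦃u v⦄, G.Adj u v → f u ≠ f v) (k : ℕ)
    (hk : ∀ v, G.degree v + 4 ≤ 2 * k) (n : ℕ) :
    ∀ p x, G.Adj p x → (side G p x).ncard ≤ n →
    ∃ h : V → ℕ, (∀ v, 1 ≤ h v) ∧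
      (∀ ⦃u v⦄, G.Adj u v → s(u, v) ≠ s(p, x) → h u ≠ h v) ∧
      (∀ v, v ∉ side G p x → h v = f v) ∧ h x ≠ f x ∧ ∑ v, h v + f x < ∑ v, f v + k := by
  induction n with
  | zero =>
    intro p x _ hn
    have := (Set.ncard_eq_zero (Set.toFinite _)).1 (Nat.le_zero.1 hn)
    exact absurd (side_self G p x) (by rw [this]; simp)
  | succ n ih =>
    intro p x hpx hn
    have hpN : p ∈ G.neighborFinset x := by simpa using hpx.symm
    have hdeg : 1 ≤ G.degree x := by
      rw [← SimpleGraph.card_neighborFinset_eq_degree]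
      exact Finset.card_pos.2 ⟨p, hpN⟩
    obtain ⟨h, h1, h2, h3, h4, h5, h6⟩ := recolor_step hG f hf1 hf k x
      ((G.neighborFinset x).erase p) (by intro z hz; simpa using (Finset.mem_erase.1 hz).2)
      (by
        intro y hy
        have hy' := Finset.mem_erase.1 hy
        have hxy : G.Adj x y := by simpa using hy'.2
        apply ih x y hxy
        have hlt : (side G x y).ncard < (side G p x).ncard := by
          apply Set.ncard_lt_ncard _ (Set.toFinite _)
          refine ⟨side_subset hG hpx hxy hy'.1, fun hh => ?_⟩
          exact side_parent hG hxy (hh (side_self G p x))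
        omega)
      ((Finset.Icc 1 (k - 1)).erase (f x))
      (by
        intro c hc
        simp only [Finset.mem_erase, Finset.mem_Icc] at hc
        have := hk x
        omega)
      (by
        rw [Finset.card_erase_of_mem hpN, SimpleGraph.card_neighborFinset_eq_degree]
        have h1 := Finset.pred_card_le_card_erase (s := Finset.Icc 1 (k - 1)) (a := f x)
        rw [Nat.card_Icc] at h1
        have := hk x
        omega)
    have hpoff : h p = f p := by
      apply h4 p hpx.ne
      intro y hy
      have hy' := Finset.mem_erase.1 hy
      have hxy : G.Adj x y := by simpa using hy'.2
      exact side_nbr hG hxy hpx.symm hy'.1.symm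
    refine ⟨h, h1, ?_, ?_, h5, h6⟩
    · intro u v huv hne
      by_cases hu : u = x
      · subst hu
        refine (h3 v ?_).symm
        rw [Finset.mem_erase]
        refine ⟨?_, by simpa using huv⟩
        rintro rfl
        exact hne Sym2.eq_swap
      · by_cases hv : v = x
        · subst hv
          refine (h3 u ?_)
          rw [Finset.mem_erase]
          refine ⟨?_, by simpa using huv.symm⟩
          rintro rfl
          exact hne rfl
        · exact h2 huv hu hv
    · intro v hv
      apply h4 v
      · rintro rfl; exact hv (side_self G p v)
      · intro y hy hvy
        have hy' := Finset.mem_erase.1 hy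
        have hxy : G.Adj x y := by simpa using hy'.2
        exact hv (side_subset hG hpx hxy hy'.1 hvy)

lemma opt_color_le [Fintype V] {G : SimpleGraph V} [DecidableRel G.Adj]
    (hG : G.IsAcyclic) (f : V → ℕ) (hf : IsProperColoring G f) (hsum : ∑ v, f v = chromSum G)
    (x : V) : 2 * f x ≤ G.maxDegree + 3 := by
  classical
  by_contra! hlt
  have hk : ∀ v, G.degree v + 4 ≤ 2 * f x := by
    intro v
    have := G.degree_le_maxDegree v
    omega
  obtain ⟨h, h1, h2, h3, h4, h5, h6⟩ := recolor_step hG f hf.1 hf.2 (f x) x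
    (G.neighborFinset x) (by intro z hz; simpa using hz)
    (by
      intro y hy
      exact recolor hG f hf.1 hf.2 (f x) hk _ x y (by simpa using hy) le_rfl)
    (Finset.Icc 1 (f x - 1))
    (by
      intro c hc
      simp only [Finset.mem_Icc] at hc
      omega)
    (by
      rw [SimpleGraph.card_neighborFinset_eq_degree, Nat.card_Icc]
      have := hk x
      omega)
  have hp : IsProperColoring G h := by
    refine ⟨h1, ?_⟩
    intro u v huv
    by_cases hu : u = x
    · subst hu
      exact (h3 v (by simpa using huv)).symm
    · by_cases hv : v = x
      · subst hv
        exact (h3 u (by simpa using huv.symm))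
      · exact h2 huv hu hv
  have : chromSum G ≤ ∑ v, h v := Nat.sInf_le ⟨h, hp, rfl⟩
  omega

lemma exists_opt [Fintype V] (G : SimpleGraph V) :
    ∃ f : V → ℕ, IsProperColoring G f ∧ ∑ v, f v = chromSum G := by
  have : {s | ∃ f : V → ℕ, IsProperColoring G f ∧ ∑ v, f v = s}.Nonempty := by
    let e := Fintype.equivFin V
    refine ⟨_, fun v => (e v : ℕ) + 1, ⟨fun v => Nat.le_add_left 1 _, ?_⟩, rfl⟩
    intro u v huv h
    apply huv.ne
    apply e.injective
    apply Fin.ext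
    simpa using h
  exact Nat.sInf_mem this

lemma strength_le [Fintype V] {G : SimpleGraph V} [DecidableRel G.Adj]
    (hG : G.IsAcyclic) : 2 * strength G ≤ G.maxDegree + 3 := by
  obtain ⟨f, hf, hs⟩ := exists_opt G
  have h1 : strength G ≤ (Finset.univ.image f).card := Nat.sInf_le ⟨f, hf, hs, rfl⟩
  have h2 : Finset.univ.image f ⊆ Finset.Icc 1 ((G.maxDegree + 3) / 2) := by
    intro c hc
    obtain ⟨v, _, rfl⟩ := Finset.mem_image.1 hc
    have := opt_color_le hG f hf hs v
    have := hf.1 v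
    rw [Finset.mem_Icc]
    omega
  have h3 := Finset.card_le_card h2
  rw [Nat.card_Icc] at h3
  omega

lemma ratio_le [Fintype V] {G : SimpleGraph V} [DecidableRel G.Adj]
    (hG : G.IsAcyclic) : (strength G : ℝ) / G.maxDegree ≤
          1 / G.maxDegree + 1 / 2 + 1 / (2 * G.maxDegree) := by
  have h : (2 : ℝ) * strength G ≤ G.maxDegree + 3 := by exact_mod_cast strength_le hG
  rcases Nat.eq_zero_or_pos G.maxDegree with h0 | h0
  · rw [h0]; norm_num
  · have hpos : (0 : ℝ) < G.maxDegree := by exact_mod_cast h0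
    have : (1 : ℝ) / G.maxDegree + 1 / 2 + 1 / (2 * G.maxDegree)
      = ((G.maxDegree + 3) / 2) / G.maxDegree := by field_simp; ring
    rw [this]
    gcongr
    linarith

end Upper

section Lower

lemma sum_acyclic_aux {V W : Type*} {G : SimpleGraph V} {H : SimpleGraph W}
    (hG : G.IsAcyclic) (hH : H.IsAcyclic) : (G ⊕g H).IsAcyclic := by
  rw [SimpleGraph.isAcyclic_iff_forall_adj_isBridge] at *
  rintro (a | a) (b | b) hab
  · rw [SimpleGraph.sum_adj_inl] at hab
    rw [SimpleGraph.isBridge_iff]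
    intro hr
    apply SimpleGraph.isBridge_iff.1 (hG hab)
    have key : ∀ y, Relation.ReflTransGen
        ((G ⊕g H).deleteEdges {s(Sum.inl a, Sum.inl b)}).Adj (Sum.inl a) y →
        ∃ v, y = Sum.inl v ∧ (G.deleteEdges {s(a, b)}).Reachable a v := by
      intro y hy
      induction hy with
      | refl => exact ⟨a, rfl, SimpleGraph.Reachable.refl _⟩
      | @tail u w _ hs ih =>
        obtain ⟨v, rfl, hv⟩ := ih
        rw [SimpleGraph.deleteEdges_adj] at hs
        rcases w with w | w
        · refine ⟨w, rfl, hv.trans (SimpleGraph.Adj.reachable ?_)⟩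
          rw [SimpleGraph.deleteEdges_adj]
          refine ⟨by simpa using hs.1, ?_⟩
          have := hs.2
          simpa [Sym2.eq_iff] using this
        · simp at hs
    obtain ⟨v, hv, hreach⟩ := key _ ((SimpleGraph.reachable_iff_reflTransGen _ _).1 hr)
    obtain rfl := Sum.inl.inj hv; exact hreach
  · simp at hab
  · simp at hab
  · rw [SimpleGraph.sum_adj_inr] at hab
    rw [SimpleGraph.isBridge_iff]
    intro hr
    apply SimpleGraph.isBridge_iff.1 (hH hab)
    have key : ∀ y, Relation.ReflTransGen
        ((G ⊕g H).deleteEdges {s(Sum.inr a, Sum.inr b)}).Adj (Sum.inr a) y →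
        ∃ v, y = Sum.inr v ∧ (H.deleteEdges {s(a, b)}).Reachable a v := by
      intro y hy
      induction hy with
      | refl => exact ⟨a, rfl, SimpleGraph.Reachable.refl _⟩
      | @tail u w _ hs ih =>
        obtain ⟨v, rfl, hv⟩ := ih
        rw [SimpleGraph.deleteEdges_adj] at hs
        rcases w with w | w
        · simp at hs
        · refine ⟨w, rfl, hv.trans (SimpleGraph.Adj.reachable ?_)⟩
          rw [SimpleGraph.deleteEdges_adj]
          refine ⟨by simpa using hs.1, ?_⟩
          have := hs.2
          simpa [Sym2.eq_iff] using this
    obtain ⟨v, hv, hreach⟩ := key _ ((SimpleGraph.reachable_iff_reflTransGen _ _).1 hr)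
    obtain rfl := Sum.inr.inj hv; exact hreach

/-- There is a rooted tree, root degree at most `n`, other degrees at most `D`, such that
a coloring with root color `x` has sum at least `F x`, with equality possible for `x = c`. -/
def Spec (c n D : ℕ) (F : ℕ → ℕ) : Prop :=
  ∃ (V : Type) (_ : Fintype V) (G : SimpleGraph V) (r : V), G.IsTree ∧
    (∀ v, v ≠ r → (G.neighborSet v).ncard ≤ D) ∧ (G.neighborSet r).ncard ≤ n ∧
    (∀ h, IsProperColoring G h → F (h r) ≤ ∑ v, h v) ∧
    ∃ h, IsProperColoring G h ∧ h r = c ∧ ∑ v, h v = F c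

lemma spec_single (c D : ℕ) (hc : 1 ≤ c) : Spec c 0 D (fun x => x) := by
  refine ⟨Unit, inferInstance, ⊥, (), SimpleGraph.IsTree.of_subsingleton, ?_, ?_, ?_, ?_⟩
  · intro v hv; exact absurd rfl hv
  · have : (⊥ : SimpleGraph Unit).neighborSet () = ∅ := by
      ext; simp
    rw [this]; simp
  · intro h _; simp
  · exact ⟨fun _ => c, ⟨fun _ => hc, fun u v huv => absurd huv (by simp)⟩, rfl, by simp⟩

lemma spec_attach {c n D d m g : ℕ} {F F' : ℕ → ℕ} (hA : Spec c n D F) (hB : Spec d m D F')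
    (hm : m + 1 ≤ D) (hg : ∀ x, 1 ≤ x → x ≠ d → F' d + g ≤ F' x) (hdc : d ≠ c) :
    Spec c (n + 1) D (fun x => F x + F' d + if x = d then g else 0) := by
  classical
  obtain ⟨V, _, G, r, hG, hG1, hG2, hG3, f, hf, hfr, hfs⟩ := hA
  obtain ⟨W, _, H, q, hH, hH1, hH2, hH3, e, he, her, hes⟩ := hB
  have ll : ∀ a b, ((G ⊕g H) ⊔ SimpleGraph.edge (Sum.inl r) (Sum.inr q)).Adj
      (Sum.inl a) (Sum.inl b) ↔ G.Adj a b := by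
    intro a b; simp [SimpleGraph.edge_adj]
  have rr : ∀ a b, ((G ⊕g H) ⊔ SimpleGraph.edge (Sum.inl r) (Sum.inr q)).Adj
      (Sum.inr a) (Sum.inr b) ↔ H.Adj a b := by
    intro a b; simp [SimpleGraph.edge_adj]
  have lr : ∀ a b, ((G ⊕g H) ⊔ SimpleGraph.edge (Sum.inl r) (Sum.inr q)).Adj
      (Sum.inl a) (Sum.inr b) ↔ a = r ∧ b = q := by
    intro a b; simp [SimpleGraph.edge_adj]
  have rl : ∀ a b, ((G ⊕g H) ⊔ SimpleGraph.edge (Sum.inl r) (Sum.inr q)).Adj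
      (Sum.inr b) (Sum.inl a) ↔ a = r ∧ b = q := by
    intro a b; rw [SimpleGraph.adj_comm]; exact lr a b
  have hT : ((G ⊕g H) ⊔ SimpleGraph.edge (Sum.inl r) (Sum.inr q)).IsTree := by
    refine ⟨SimpleGraph.Connected.sum_sup_edge hG.1 hH.1, ?_⟩
    exact SimpleGraph.IsAcyclic.sup_edge_of_not_reachable
      (SimpleGraph.not_reachable_sum_inl_inr r q) (sum_acyclic_aux hG.2 hH.2)
  refine ⟨V ⊕ W, inferInstance, (G ⊕g H) ⊔ SimpleGraph.edge (Sum.inl r) (Sum.inr q),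
    Sum.inl r, hT, ?_, ?_, ?_, ?_⟩
  · rintro (v | w) hv
    · have hv' : v ≠ r := fun h => hv (by rw [h])
      refine le_trans ?_ (hG1 v hv')
      rw [← Set.ncard_image_of_injective (G.neighborSet v) (Sum.inl_injective (β := W))]
      apply Set.ncard_le_ncard _ (Set.toFinite _)
      rintro (b | b) hb
      · exact ⟨b, (ll _ _).1 hb, rfl⟩
      · exact absurd ((lr _ _).1 hb).1 hv'
    · by_cases hw : w = q
      · subst hw
        refine le_trans ?_ hm
        refine le_trans ?_ (Nat.add_le_add_right hH2 1)
        rw [← Set.ncard_image_of_injective (H.neighborSet w) (Sum.inr_injective (α := V))]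
        refine le_trans (Set.ncard_le_ncard (t := insert (Sum.inl r) _) ?_ (Set.toFinite _))
          (Set.ncard_insert_le _ _)
        rintro (b | b) hb
        · left; rw [((rl _ _).1 hb).1]
        · right; exact ⟨b, (rr _ _).1 hb, rfl⟩
      · refine le_trans ?_ (hH1 w hw)
        rw [← Set.ncard_image_of_injective (H.neighborSet w) (Sum.inr_injective (α := V))]
        apply Set.ncard_le_ncard _ (Set.toFinite _)
        rintro (b | b) hb
        · exact absurd ((rl _ _).1 hb).2 hw
        · exact ⟨b, (rr _ _).1 hb, rfl⟩
  · refine le_trans ?_ (Nat.add_le_add_right hG2 1)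
    rw [← Set.ncard_image_of_injective (G.neighborSet r) (Sum.inl_injective (β := W))]
    refine le_trans (Set.ncard_le_ncard (t := insert (Sum.inr q) _) ?_ (Set.toFinite _))
      (Set.ncard_insert_le _ _)
    rintro (b | b) hb
    · right; exact ⟨b, (ll _ _).1 hb, rfl⟩
    · left; rw [((lr _ _).1 hb).2]
  · intro h hh
    rw [Fintype.sum_sum_type]
    have h1 := hG3 (fun v => h (Sum.inl v))
      ⟨fun v => hh.1 _, fun u v huv => hh.2 ((ll u v).2 huv)⟩
    have h2 := hH3 (fun v => h (Sum.inr v))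
      ⟨fun v => hh.1 _, fun u v huv => hh.2 ((rr u v).2 huv)⟩
    have h3 := hh.2 ((lr r q).2 ⟨rfl, rfl⟩)
    have h4 := hg (h (Sum.inr q)) (hh.1 _)
    dsimp only at h1 h2 ⊢
    split_ifs with hd
    · have := h4 (by rw [← hd]; exact h3.symm)
      omega
    · by_cases hq : h (Sum.inr q) = d
      · rw [hq] at h2
        omega
      · have := h4 hq
        omega
  · refine ⟨Sum.elim f e, ⟨?_, ?_⟩, by simpa using hfr, ?_⟩
    · rintro (v | w)
      · exact hf.1 v
      · exact he.1 w
    · rintro (a | a) (b | b) hab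
      · exact hf.2 ((ll _ _).1 hab)
      · obtain ⟨rfl, rfl⟩ := (lr _ _).1 hab
        simp only [Sum.elim_inl, Sum.elim_inr, hfr, her]
        exact hdc.symm
      · obtain ⟨rfl, rfl⟩ := (rl _ _).1 hab
        simp only [Sum.elim_inl, Sum.elim_inr, hfr, her]
        exact hdc
      · exact he.2 ((rr _ _).1 hab)
    · rw [Fintype.sum_sum_type]
      simp only [Sum.elim_inl, Sum.elim_inr, hfs, hes, if_neg hdc.symm, add_zero]

/-- A rooted tree whose root strongly prefers color `c`: any other color costs `g` more. -/
def Good (c g D : ℕ) : Prop :=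
  ∃ (m : ℕ) (F : ℕ → ℕ), m + 1 ≤ D ∧ Spec c m D F ∧ ∀ x, 1 ≤ x → x ≠ c → F c + g ≤ F x

lemma spec_mono {c n D D' : ℕ} {F : ℕ → ℕ} (h : Spec c n D F) (hD : D ≤ D') : Spec c n D' F := by
  obtain ⟨V, i, G, r, hG, hG1, h'⟩ := h
  exact ⟨V, i, G, r, hG, fun v hv => (hG1 v hv).trans hD, h'⟩

lemma good_mono {c g D D' : ℕ} (h : Good c g D) (hD : D ≤ D') : Good c g D' := by
  obtain ⟨m, F, h1, h2, h3⟩ := h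
  exact ⟨m, F, h1.trans hD, spec_mono h2 hD, h3⟩

lemma spec_list (c D : ℕ) (hc : 1 ≤ c) (γ : ℕ → ℕ) (l : List ℕ)
    (hl : ∀ d ∈ l, d ≠ c ∧ Good d (γ d) D) :
    ∃ B, Spec c l.length D (fun x => x + B + l.count x * γ x) := by
  induction l with
  | nil => exact ⟨0, by simpa using spec_single c D hc⟩
  | cons d l ih =>
    obtain ⟨B, hB⟩ := ih fun d hd => hl d (List.mem_cons_of_mem _ hd)
    obtain ⟨hdc, m, F, hm, hF, hg⟩ := hl d List.mem_cons_self
    refine ⟨B + F d, ?_⟩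
    have := spec_attach hB hF hm hg hdc
    rw [List.length_cons]
    convert this using 2 with x
    rw [List.count_cons]
    by_cases hx : x = d
    · subst hx; simp; ring
    · have hx' : ¬ d = x := fun h => hx h.symm
      simp [hx, hx']; ring

lemma good_list (c g D : ℕ) (hc : 1 ≤ c) (γ : ℕ → ℕ) (l : List ℕ)
    (hl : ∀ d ∈ l, d ≠ c ∧ Good d (γ d) D) (hlen : l.length + 1 ≤ D)
    (hg : ∀ x, 1 ≤ x → x ≠ c → c + g ≤ x + l.count x * γ x) : Good c g D := by
  obtain ⟨B, hB⟩ := spec_list c D hc γ l hl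
  refine ⟨_, _, hlen, hB, ?_⟩
  intro x hx hxc
  have h0 : l.count c = 0 := List.count_eq_zero.2 fun h => (hl c h).1 rfl
  have := hg x hx hxc
  simp only [h0]
  omega

lemma good_finset (c g D : ℕ) (hc : 1 ≤ c) (γ : ℕ → ℕ) (s : Finset ℕ)
    (hl : ∀ d ∈ s, d ≠ c ∧ Good d (γ d) D) (hlen : 2 * s.card + 1 ≤ D)
    (hg : ∀ x, 1 ≤ x → x ≠ c → c + g ≤ x + if x ∈ s then 2 * γ x else 0) : Good c g D := by
  apply good_list c g D hc γ (s.toList ++ s.toList)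
  · intro d hd
    apply hl
    simpa using hd
  · rw [List.length_append, Finset.length_toList]; omega
  · intro x hx hxc
    have := hg x hx hxc
    rw [List.count_append]
    split_ifs at this with hxs
    · rw [List.count_eq_one_of_mem s.nodup_toList (by simpa using hxs)]
      omega
    · rw [List.count_eq_zero.2 (by simpa using hxs)]
      omega

lemma good_all (j : ℕ) : ∀ c, 1 ≤ c → c ≤ j → Good c (j + 1 - c) (2 * j) := by
  induction j with
  | zero => intro c h1 h2; omega
  | succ j ih =>
    have ih' : ∀ c, 1 ≤ c → c ≤ j → Good c (j + 1 - c) (2 * (j + 1)) := fun c h1 h2 =>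
      good_mono (ih c h1 h2) (by omega)
    have htop : Good (j + 1) 1 (2 * (j + 1)) := by
      apply good_finset (j + 1) 1 _ (by omega) (fun x => j + 1 - x) (Finset.Icc 1 j)
      · intro d hd
        rw [Finset.mem_Icc] at hd
        exact ⟨by omega, ih' d hd.1 hd.2⟩
      · rw [Nat.card_Icc]; omega
      · intro x hx hxc
        simp only [Finset.mem_Icc]
        split_ifs <;> omega
    intro c h1 h2
    rcases Nat.lt_or_ge j c with hjc | hjc
    · obtain rfl : c = j + 1 := by omega
      have : j + 1 + 1 - (j + 1) = 1 := by omega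
      rw [this]; exact htop
    · apply good_finset c _ _ h1 (fun x => if x = j + 1 then 1 else j + 1 - x)
        ((Finset.Icc 1 (j + 1)).erase c)
      · intro d hd
        rw [Finset.mem_erase, Finset.mem_Icc] at hd
        refine ⟨hd.1, ?_⟩
        split_ifs with h
        · rw [h]; exact htop
        · exact ih' d hd.2.1 (by omega)
      · rw [Finset.card_erase_of_mem (by rw [Finset.mem_Icc]; omega), Nat.card_Icc]; omega
      · intro x hx hxc
        simp only [Finset.mem_erase, Finset.mem_Icc]
        split_ifs <;> omega

lemma exists_tree (k : ℕ) (hk : 1 ≤ k) : ∃ (V : Type) (_ : Fintype V) (G : SimpleGraph V),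
    G.IsTree ∧ (∀ v, (G.neighborSet v).ncard ≤ 2 * k) ∧ k ≤ strength G := by
  classical
  obtain ⟨m, F, hm, ⟨V, _, G, r, hG, hG1, hG2, hG3, f, hf, hfr, hfs⟩, hF⟩ :=
    good_all k k hk le_rfl
  refine ⟨V, inferInstance, G, hG, ?_, ?_⟩
  · intro v
    by_cases hv : v = r
    · subst hv; omega
    · exact hG1 v hv
  · obtain ⟨f0, hf0, hs0⟩ := exists_opt G
    unfold strength
    apply le_csInf
    · exact ⟨_, f0, hf0, hs0, rfl⟩
    rintro n ⟨h, hh, hs, rfl⟩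
    have hle : ∑ v, h v ≤ F k := by
      rw [hs, ← hfs]; exact Nat.sInf_le ⟨f, hf, rfl⟩
    have hr : h r = k := by
      by_contra hne
      have h1 := hF (h r) (hh.1 r) hne
      have h2 := hG3 h hh
      omega
    have hsub : Finset.Icc 1 k ⊆ Finset.univ.image h := by
      intro c hc
      rw [Finset.mem_Icc] at hc
      by_contra hcn
      have hne : ∀ v, h v ≠ c := fun v hv => hcn (Finset.mem_image.2 ⟨v, Finset.mem_univ _, hv⟩)
      have hp : IsProperColoring G (Function.update h r c) := by
        refine ⟨?_, ?_⟩
        · intro v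
          by_cases hv : v = r
          · subst hv; simpa using hc.1
          · rw [Function.update_of_ne hv]; exact hh.1 v
        · intro u v huv
          by_cases hu : u = r
          · subst hu
            rw [Function.update_self, Function.update_of_ne huv.ne']
            exact (hne v).symm
          · by_cases hv : v = r
            · subst hv
              rw [Function.update_self, Function.update_of_ne hu]
              exact hne u
            · rw [Function.update_of_ne hu, Function.update_of_ne hv]
              exact hh.2 huv
      have h1 : chromSum G ≤ ∑ v, Function.update h r c v := Nat.sInf_le ⟨_, hp, rfl⟩
      have h2 := sum_update h r c
      have h3 := hne r
      omega
    have := Finset.card_le_card hsub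
    rw [Nat.card_Icc] at this
    omega

lemma iso_chromSum_aux {V W : Type*} [Fintype V] [Fintype W] {G : SimpleGraph V}
    {H : SimpleGraph W} (e : G ≃g H) {f : V → ℕ} (hf : IsProperColoring G f) :
    IsProperColoring H (fun w => f (e.symm w)) ∧ ∑ w, f (e.symm w) = ∑ v, f v ∧
    Finset.univ.image (fun w => f (e.symm w)) = Finset.univ.image f := by
  refine ⟨⟨fun w => hf.1 _, fun u v huv => hf.2 (e.symm.map_adj_iff.2 huv)⟩, ?_, ?_⟩
  · exact Equiv.sum_comp e.symm.toEquiv f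
  · ext c
    simp only [Finset.mem_image, Finset.mem_univ, true_and]
    constructor
    · rintro ⟨w, hw⟩; exact ⟨_, hw⟩
    · rintro ⟨v, hv⟩; exact ⟨e v, by simpa using hv⟩

lemma iso_chromSum_le {V W : Type*} [Fintype V] [Fintype W] {G : SimpleGraph V}
    {H : SimpleGraph W} (e : G ≃g H) : chromSum H ≤ chromSum G := by
  obtain ⟨f, hf, hs⟩ := exists_opt G
  obtain ⟨h1, h2, _⟩ := iso_chromSum_aux e hf
  exact Nat.sInf_le ⟨_, h1, h2.trans hs⟩

lemma iso_strength_le {V W : Type*} [Fintype V] [Fintype W] {G : SimpleGraph V}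
    {H : SimpleGraph W} (e : G ≃g H) : strength H ≤ strength G := by
  obtain ⟨f0, hf0, hs0⟩ := exists_opt G
  have hc : chromSum H = chromSum G := le_antisymm (iso_chromSum_le e) (iso_chromSum_le e.symm)
  obtain ⟨f, hf, hs, hn⟩ := Nat.sInf_mem (s := {n | ∃ f : V → ℕ, IsProperColoring G f ∧
    ∑ v, f v = chromSum G ∧ (Finset.univ.image f).card = n}) ⟨_, f0, hf0, hs0, rfl⟩
  obtain ⟨h1, h2, h3⟩ := iso_chromSum_aux e hf
  exact Nat.sInf_le ⟨_, h1, h2.trans (hs.trans hc.symm), by rw [h3, hn]; rfl⟩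

lemma exists_tree_fin (k : ℕ) (hk : 1 ≤ k) : ∃ (c : ℕ) (G : SimpleGraph (Fin c))
    (_ : DecidableRel G.Adj), G.IsTree ∧ G.maxDegree ≤ 2 * k ∧ k ≤ strength G := by
  classical
  obtain ⟨V, _, G, hG, hd, hs⟩ := exists_tree k hk
  let e : V ≃ Fin (Fintype.card V) := Fintype.equivFin V
  let φ : G ≃g G.map e.toEmbedding := SimpleGraph.Iso.map e G
  refine ⟨_, G.map e.toEmbedding, inferInstance, φ.isTree_iff.1 hG, ?_,
    hs.trans (iso_strength_le φ.symm)⟩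
  apply SimpleGraph.maxDegree_le_of_forall_degree_le
  intro w
  obtain ⟨v, rfl⟩ := φ.surjective w
  have h1 := hd v
  rw [Set.ncard_eq_toFinset_card', Set.toFinset_card, SimpleGraph.card_neighborSet_eq_degree] at h1
  rw [φ.degree_eq v]
  exact h1

end Lower

lemma ratio_limit_aux {D : ℕ → ℕ} (h : Filter.Tendsto D Filter.atTop Filter.atTop) :
    Filter.Tendsto (fun n => (1 : ℝ) / D n + 1 / 2 + 1 / (2 * D n))
      Filter.atTop (nhds (1 / 2)) := by
  have hR : Filter.Tendsto (fun n => (D n : ℝ)) Filter.atTop Filter.atTop :=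
    tendsto_natCast_atTop_atTop.comp h
  have h1 : Filter.Tendsto (fun n => (1 : ℝ) / D n) Filter.atTop (nhds 0) :=
    tendsto_const_nhds.div_atTop hR
  have h2 : Filter.Tendsto (fun n => (1 : ℝ) / (2 * D n)) Filter.atTop (nhds 0) :=
    tendsto_const_nhds.div_atTop (hR.const_mul_atTop (by norm_num))
  simpa using (h1.add_const (1 / 2 : ℝ)).add h2

open Filter in
/-- The ratio `s(T)/Δ(T)` is bounded for nontrivial trees, and `1/2` is the
supremum of limit points of `s(T_n)/Δ(T_n)` over sequences of trees with
`Δ(T_n) → ∞`. -/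
theorem strength_ratio :
    (∀ (V : Type) (_ : Fintype V) (T : SimpleGraph V) (_ : DecidableRel T.Adj),
      T.IsTree → 2 ≤ Fintype.card V →
        (strength T : ℝ) / T.maxDegree ≤
          1 / T.maxDegree + 1 / 2 + 1 / (2 * T.maxDegree)) ∧
    (∀ (c : ℕ → ℕ) (T : ∀ n : ℕ, SimpleGraph (Fin (c n)))
        (_ : ∀ n, DecidableRel (T n).Adj), (∀ n, (T n).IsTree) →
        Tendsto (fun n => (T n).maxDegree) atTop atTop →
        ∀ L : ℝ, MapClusterPt L atTop
            (fun n => (strength (T n) : ℝ) / (T n).maxDegree) →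
          L ≤ 1 / 2) ∧
    (∃ (c : ℕ → ℕ) (T : ∀ n : ℕ, SimpleGraph (Fin (c n)))
        (_ : ∀ n, DecidableRel (T n).Adj), (∀ n, (T n).IsTree) ∧
        Tendsto (fun n => (T n).maxDegree) atTop atTop ∧
        Tendsto (fun n => (strength (T n) : ℝ) / (T n).maxDegree) atTop
          (nhds (1 / 2))) := by
  refine ⟨fun V _ T _ hT _ => ratio_le hT.2, ?_, ?_⟩
  · intro c T _ hT hlim L hL
    have hb : Tendsto (fun n => (1 : ℝ) / (T n).maxDegree + 1 / 2 + 1 / (2 * (T n).maxDegree))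
        atTop (nhds (1 / 2)) := ratio_limit_aux hlim
    by_contra! hlt
    obtain ⟨M, h1, h2⟩ := exists_between hlt
    have hev : ∀ᶠ n in atTop, (strength (T n) : ℝ) / (T n).maxDegree < M := by
      filter_upwards [hb.eventually (gt_mem_nhds h1)] with n hn
      exact (ratio_le (hT n).2).trans_lt hn
    have hfr := hL.frequently (lt_mem_nhds h2)
    obtain ⟨n, hn1, hn2⟩ := (hfr.and_eventually hev).exists
    exact absurd hn1 (not_lt.2 hn2.le)
  · choose c T d hT hD hs using fun n : ℕ => exists_tree_fin (n + 1) (by omega)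
    have hlim : Tendsto (fun n => (T n).maxDegree) atTop atTop := by
      refine tendsto_atTop_mono (f := fun n => n - 1) ?_ (tendsto_sub_atTop_nat 1)
      intro n
      have h1 := strength_le (hT n).2
      have h2 := hs n
      show n - 1 ≤ _
      omega
    refine ⟨c, T, d, hT, hlim, ?_⟩
    refine tendsto_of_tendsto_of_tendsto_of_le_of_le' tendsto_const_nhds
      (ratio_limit_aux hlim) ?_ (Eventually.of_forall fun n => ratio_le (hT n).2)
    filter_upwards [hlim.eventually_ge_atTop 1] with n hn
    have hpos : (0 : ℝ) < (T n).maxDegree := by exact_mod_cast hn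
    rw [le_div_iff₀ hpos]
    have h1 : ((T n).maxDegree : ℝ) ≤ 2 * (n + 1) := by exact_mod_cast hD n
    have h2 : ((n : ℝ) + 1) ≤ strength (T n) := by exact_mod_cast hs n
    linarith
end
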